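/- Let n ≥ 2, 0 < δ ≤ n, and 0 ≤ κ < n. If δ/n < p < δ/κ (with δ/κ interpreted as ∞ when κ = 0), then there exists a constant c depending only on n, δ, κ, and p such that for every f ∈ L¹_loc(ℝⁿ): ∫_{ℝⁿ} (M_κ f(x))^p dH^{δ−κp}_∞ ≤ c ∫_{ℝⁿ} |f(x)|^p dH^δ_∞. -/

import Mathlib

open MeasureTheory Metric Set Bornology
open scoped ENNReal NNReal

/-- The `δ`-dimensional Hausdorff content of a set `E ⊆ ℝⁿ`, defined as the infimum of
`∑ᵢ rᵢ^δ` over all countable coverings of `E` by open balls `B(xᵢ, rᵢ)`. -/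
noncomputable def hContent (n : ℕ) (δ : ℝ) (E : Set (EuclideanSpace ℝ (Fin n))) : ℝ≥0∞ :=
  ⨅ (x : ℕ → EuclideanSpace ℝ (Fin n)) (r : ℕ → ℝ≥0)
    (_ : E ⊆ ⋃ i, Metric.ball (x i) (r i)), ∑' i, (r i : ℝ≥0∞) ^ δ

/-- The `δ`-dimensional Hausdorff measure of `E ⊆ ℝⁿ`, obtained from coverings by open balls of
radii at most `ρ`, in the limit `ρ → 0⁺` (equivalently: the supremum over `ρ > 0`, since the
infima increase as `ρ` decreases). -/
noncomputable def hMeasure (n : ℕ) (δ : ℝ) (E : Set (EuclideanSpace ℝ (Fin n))) : ℝ≥0∞ :=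
  ⨆ (ρ : ℝ≥0) (_ : 0 < ρ),
    ⨅ (x : ℕ → EuclideanSpace ℝ (Fin n)) (r : ℕ → ℝ≥0)
      (_ : E ⊆ ⋃ i, Metric.ball (x i) (r i)) (_ : ∀ i, r i ≤ ρ), ∑' i, (r i : ℝ≥0∞) ^ δ

/-- The Choquet integral `∫_Ω f dH^δ_∞ = ∫₀^∞ H^δ_∞({x ∈ Ω : f x > t}) dt` of a
(nonnegative) real-valued function with respect to the Hausdorff content. -/
noncomputable def choquet (n : ℕ) (δ : ℝ) (Ω : Set (EuclideanSpace ℝ (Fin n)))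
    (f : EuclideanSpace ℝ (Fin n) → ℝ) : ℝ≥0∞ :=
  ∫⁻ t in Set.Ioi (0 : ℝ), hContent n δ {x ∈ Ω | t < f x}

/-- The Choquet integral of an `[0,∞]`-valued function with respect to the Hausdorff content. -/
noncomputable def echoquet (n : ℕ) (δ : ℝ) (Ω : Set (EuclideanSpace ℝ (Fin n)))
    (f : EuclideanSpace ℝ (Fin n) → ℝ≥0∞) : ℝ≥0∞ :=
  ∫⁻ t in Set.Ioi (0 : ℝ), hContent n δ {x ∈ Ω | ENNReal.ofReal t < f x}

/-- The centered fractional Hardy–Littlewood maximal function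
`M_κ f (x) = sup_{r>0} r^{κ-n} ∫_{B(x,r)} |f|`. -/
noncomputable def fracMaximal (n : ℕ) (κ : ℝ) (f : EuclideanSpace ℝ (Fin n) → ℝ)
    (x : EuclideanSpace ℝ (Fin n)) : ℝ≥0∞ :=
  ⨆ (r : ℝ) (_ : 0 < r),
    ENNReal.ofReal (r ^ (κ - n)) * ∫⁻ y in Metric.ball x r, ENNReal.ofReal |f y|

/-- The Riesz potential of order `1`: `I₁ f (x) = ∫_{ℝⁿ} |f y| / |x-y|^{n-1} dy`. -/
noncomputable def rieszPot (n : ℕ) (f : EuclideanSpace ℝ (Fin n) → ℝ)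
    (x : EuclideanSpace ℝ (Fin n)) : ℝ≥0∞ :=
  ∫⁻ y, ENNReal.ofReal |f y| / edist x y ^ ((n : ℝ) - 1)

/-- `Ω` is an `(α, β)`-John domain with John center `x₀`: every `x ∈ Ω` can be joined to `x₀`
by a rectifiable curve `γ : [0, L] → Ω` parametrized by arclength (hence `1`-Lipschitz) with
`γ 0 = x`, `γ L = x₀`, `L ≤ β` and `dist (γ t, ∂Ω) ≥ (α/β) t`. -/
def IsJohnDomainWithCenter (n : ℕ) (α β : ℝ) (Ω : Set (EuclideanSpace ℝ (Fin n)))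
    (x₀ : EuclideanSpace ℝ (Fin n)) : Prop :=
  x₀ ∈ Ω ∧ ∀ x ∈ Ω, ∃ L : ℝ, 0 ≤ L ∧ L ≤ β ∧ ∃ γ : ℝ → EuclideanSpace ℝ (Fin n),
    γ 0 = x ∧ γ L = x₀ ∧ (∀ t ∈ Set.Icc 0 L, γ t ∈ Ω) ∧
    LipschitzOnWith 1 γ (Set.Icc 0 L) ∧
    ∀ t ∈ Set.Icc 0 L, α / β * t ≤ Metric.infDist (γ t) (frontier Ω)

/-- `Ω` is an `(α, β)`-John domain. -/
def IsJohnDomain (n : ℕ) (α β : ℝ) (Ω : Set (EuclideanSpace ℝ (Fin n))) : Prop :=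
  ∃ x₀, IsJohnDomainWithCenter n α β Ω x₀

/-- The index of the dyadic cube of side length `2 ^ k` containing `x`. -/
noncomputable def dyIdx {n : ℕ} (k : ℤ) (x : EuclideanSpace ℝ (Fin n)) : Fin n → ℤ :=
  fun i => ⌊x i / 2 ^ k⌋

/-- The half-open dyadic cube of side length `2 ^ k` with index `m`. -/
def dyCube {n : ℕ} (k : ℤ) (m : Fin n → ℤ) : Set (EuclideanSpace ℝ (Fin n)) :=
  {x | dyIdx k x = m}

/-- The index of the dyadic parent of the cube with index `m`. -/
def dyPar {n : ℕ} (m : Fin n → ℤ) : Fin n → ℤ := fun i => m i / 2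

/-- The sum of the weights `b` over all dyadic cubes containing the cube with index `m` at
scale `k`. -/
noncomputable def dySum {n : ℕ} (b : ℤ → (Fin n → ℤ) → ℝ≥0∞) (k : ℤ) (m : Fin n → ℤ) : ℝ≥0∞ :=
  ∑' l : ℕ, b (k + l) (dyPar^[l] m)

/-- Two dyadic cubes of the same scale are adjacent or equal. -/
def DyNear {n : ℕ} (m m' : Fin n → ℤ) : Prop := ∀ i, |m i - m' i| ≤ 1

theorem dyIdx_succ {n : ℕ} (k : ℤ) (x : EuclideanSpace ℝ (Fin n)) :
    dyIdx (k + 1) x = dyPar (dyIdx k x) := by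
  funext i
  simp only [dyIdx, dyPar]
  have h : x i / (2 : ℝ) ^ (k + 1) = (x i / 2 ^ k) / (2 : ℕ) := by
    rw [zpow_add_one₀ (by norm_num), div_div]; norm_num
  rw [h, Int.floor_div_natCast]
  norm_num

theorem dyIdx_add {n : ℕ} (k : ℤ) (l : ℕ) (x : EuclideanSpace ℝ (Fin n)) :
    dyIdx (k + l) x = dyPar^[l] (dyIdx k x) := by
  induction l with
  | zero => simp
  | succ l ih =>
    rw [Function.iterate_succ_apply', ← ih, ← dyIdx_succ]
    push_cast
    rw [add_assoc]

theorem dySum_succ {n : ℕ} (b : ℤ → (Fin n → ℤ) → ℝ≥0∞) (k : ℤ) (m : Fin n → ℤ) :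
    dySum b k m = b k m + dySum b (k + 1) (dyPar m) := by
  unfold dySum
  rw [tsum_eq_zero_add' ENNReal.summable]
  simp only [Nat.cast_zero, add_zero, Function.iterate_zero, id_eq, Function.iterate_succ_apply]
  congr 1
  refine tsum_congr fun l => ?_
  congr 1
  push_cast
  ring

theorem DyNear.iterate {n : ℕ} {m m' : Fin n → ℤ} (h : DyNear m m') (l : ℕ) :
    DyNear (dyPar^[l] m) (dyPar^[l] m') := by
  induction l with
  | zero => simpa
  | succ l ih =>
    rw [Function.iterate_succ_apply', Function.iterate_succ_apply']
    intro i
    have := ih i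
    simp only [dyPar]
    rw [abs_le] at this ⊢
    omega

theorem hContent_le_tsum {n : ℕ} {ι : Type*} [Countable ι] [Infinite ι] {d : ℝ}
    {E : Set (EuclideanSpace ℝ (Fin n))} (x : ι → EuclideanSpace ℝ (Fin n)) (r : ι → ℝ≥0)
    (h : E ⊆ ⋃ i, ball (x i) (r i)) : hContent n d E ≤ ∑' i, (r i : ℝ≥0∞) ^ d := by
  obtain ⟨_⟩ := nonempty_denumerable ι
  let e : ℕ ≃ ι := (Denumerable.eqv ι).symm
  rw [← e.tsum_eq]
  refine iInf_le_of_le (fun j => x (e j)) (iInf_le_of_le (fun j => r (e j)) (iInf_le _ ?_))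
  intro y hy
  obtain ⟨i, hi⟩ := mem_iUnion.1 (h hy)
  exact mem_iUnion.2 ⟨e.symm i, by simpa using hi⟩

theorem dist_le_of_dyNear {n : ℕ} {k : ℤ} {m : Fin n → ℤ} {x : EuclideanSpace ℝ (Fin n)}
    (h : DyNear m (dyIdx k x)) :
    dist x (WithLp.toLp 2 fun i => (m i : ℝ) * 2 ^ k) ≤ 2 * n * 2 ^ k := by
  have hk : (0 : ℝ) < 2 ^ k := by positivity
  have hi : ∀ i, |x i - m i * 2 ^ k| ≤ 2 * 2 ^ k := by
    intro i
    have h1 := h i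
    simp only [dyIdx] at h1
    have h2 := Int.floor_le (x i / 2 ^ k)
    have h3 := Int.lt_floor_add_one (x i / 2 ^ k)
    rw [le_div_iff₀ hk] at h2
    rw [div_lt_iff₀ hk] at h3
    rw [abs_le] at h1 ⊢
    have h4 : ((m i : ℤ) : ℝ) - (⌊x i / 2 ^ k⌋ : ℝ) ≤ 1 := by exact_mod_cast h1.2
    have h5 : (-1 : ℝ) ≤ ((m i : ℤ) : ℝ) - (⌊x i / 2 ^ k⌋ : ℝ) := by exact_mod_cast h1.1
    constructor <;> nlinarith
  rw [EuclideanSpace.dist_eq]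
  refine Real.sqrt_le_iff.2 ⟨by positivity, ?_⟩
  calc _ ≤ ∑ i : Fin n, (2 * 2 ^ k : ℝ) ^ 2 := by
        refine Finset.sum_le_sum fun i _ => ?_
        rw [Real.dist_eq]
        exact pow_le_pow_left₀ (abs_nonneg _) (hi i) 2
    _ = n * (2 * 2 ^ k) ^ 2 := by simp
    _ ≤ (2 * n * 2 ^ k) ^ 2 := by
        have : (n : ℝ) ≤ (n : ℝ) ^ 2 := by
          exact_mod_cast Nat.le_self_pow two_ne_zero n
        nlinarith [sq_nonneg ((2 : ℝ) * 2 ^ k)]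

theorem coe_two_zpow (k : ℤ) : (((2 : ℝ≥0) ^ k : ℝ≥0) : ℝ≥0∞) = 2 ^ (k : ℝ) := by
  rw [ENNReal.rpow_intCast, ENNReal.coe_zpow (by norm_num)]
  norm_num

/-- The set of points adjacent to a dyadic cube whose accumulated weight exceeds `t` has Choquet
distribution controlled by the total weighted mass. -/
theorem lintegral_hContent_dySum_le {n : ℕ} (hn0 : 0 < n) {d : ℝ} (hd : 0 < d)
    (b : ℤ → (Fin n → ℤ) → ℝ≥0∞) :
    ∫⁻ t in Ioi (0 : ℝ), hContent n d
        {x | ∃ k m, DyNear m (dyIdx k x) ∧ ENNReal.ofReal t < dySum b k m}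
      ≤ (2 * n + 1) ^ d * ∑' (k : ℤ) (m), b k m * 2 ^ (k * d) := by
  classical
  by_cases hfin : ∑' (k : ℤ) (m), b k m * 2 ^ (k * d) = ⊤
  · rw [hfin, ENNReal.mul_top]
    · exact le_top
    · simp [hd.le]
  have hS : ∀ k m, dySum b k m ≠ ⊤ := by
    intro k m
    have h1 : dySum b k m * 2 ^ (k * d) ≤ ∑' (k : ℤ) (m), b k m * 2 ^ (k * d) := by
      unfold dySum
      rw [← ENNReal.tsum_mul_right]
      calc ∑' l : ℕ, b (k + l) (dyPar^[l] m) * 2 ^ (k * d)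
          ≤ ∑' l : ℕ, ∑' m, b (k + l) m * 2 ^ (((k + l : ℤ) : ℝ) * d) := by
            refine ENNReal.tsum_le_tsum fun l => ?_
            refine le_trans ?_ (ENNReal.le_tsum (dyPar^[l] m))
            gcongr
            · norm_num
            · linarith [(Nat.cast_nonneg l : (0:ℝ) ≤ l)]
        _ ≤ _ := by
            refine ENNReal.tsum_comp_le_tsum_of_injective (f := fun l : ℕ => k + (l : ℤ))
              (fun a b h => by simpa using h) (fun k => ∑' m, b k m * 2 ^ ((k : ℝ) * d))
    intro h
    rw [h, ENNReal.top_mul] at h1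
    · exact hfin (top_le_iff.1 h1)
    · exact (ENNReal.rpow_pos (by norm_num) (by norm_num)).ne'
  let T : ℤ × (Fin n → ℤ) → Set ℝ := fun q =>
    {t | dySum b (q.1 + 1) (dyPar q.2) ≤ ENNReal.ofReal t ∧
      ENNReal.ofReal t < dySum b q.1 q.2}
  have hTm : ∀ q, MeasurableSet (T q) := fun q =>
    (measurableSet_le measurable_const ENNReal.measurable_ofReal).inter
      (measurableSet_lt ENNReal.measurable_ofReal measurable_const)
  have hTv : ∀ q, volume.restrict (Ioi (0 : ℝ)) (T q) ≤ b q.1 q.2 := by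
    intro q
    rw [Measure.restrict_apply (hTm q)]
    calc volume (T q ∩ Ioi 0)
        ≤ volume (Ico (dySum b (q.1 + 1) (dyPar q.2)).toReal (dySum b q.1 q.2).toReal) := by
          refine measure_mono ?_
          rintro t ⟨⟨h1, h2⟩, h3⟩
          exact ⟨ENNReal.toReal_le_of_le_ofReal (le_of_lt h3) h1,
            (ENNReal.ofReal_lt_iff_lt_toReal (le_of_lt h3) (hS _ _)).1 h2⟩
      _ ≤ b q.1 q.2 := by
          rw [Real.volume_Ico, dySum_succ b q.1, ENNReal.toReal_add _ (hS _ _)]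
          · simpa using ENNReal.ofReal_toReal_le
          · have := hS q.1 q.2
            rw [dySum_succ] at this
            exact fun h => this (by simp [h])
  have key : ∀ t : ℝ, 0 < t → hContent n d
      {x | ∃ k m, DyNear m (dyIdx k x) ∧ ENNReal.ofReal t < dySum b k m} ≤
      ∑' q : ℤ × (Fin n → ℤ), (T q).indicator (fun _ => (2 * n + 1 : ℝ≥0∞) ^ d * 2 ^ (q.1 * d)) t := by
    intro t ht
    let r : ℤ × (Fin n → ℤ) → ℝ≥0 := fun q => if t ∈ T q then (2 * n + 1) * 2 ^ q.1 else 0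
    have hr : ∀ q, (r q : ℝ≥0∞) ^ d
        = (T q).indicator (fun _ => (2 * n + 1 : ℝ≥0∞) ^ d * 2 ^ (q.1 * d)) t := by
      intro q
      by_cases hq : t ∈ T q
      · simp only [r, hq, if_true, indicator_of_mem]
        rw [ENNReal.coe_mul, coe_two_zpow, ENNReal.mul_rpow_of_nonneg _ _ hd.le,
          ENNReal.rpow_mul]
        norm_num
      · simp [r, hq, hd]
    simp_rw [← hr]
    have : Nonempty (Fin n) := ⟨⟨0, hn0⟩⟩
    refine hContent_le_tsum (fun q => WithLp.toLp 2 fun i => (q.2 i : ℝ) * 2 ^ q.1) r ?_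
    rintro x ⟨k, m, hnear, hlt⟩
    have htend : ∃ l : ℕ, dySum b (k + l) (dyPar^[l] m) ≤ ENNReal.ofReal t := by
      have h1 := ENNReal.tendsto_sum_nat_add (fun l : ℕ => b (k + l) (dyPar^[l] m)) (hS k m)
      obtain ⟨l, hl⟩ := (h1.eventually (eventually_le_nhds (ENNReal.ofReal_pos.2 ht))).exists
      refine ⟨l, le_trans (le_of_eq ?_) hl⟩
      unfold dySum
      refine tsum_congr fun j => ?_
      rw [Function.iterate_add_apply]
      congr 1
      push_cast
      ring
    let l := Nat.find htend
    have hl : dySum b (k + l) (dyPar^[l] m) ≤ ENNReal.ofReal t := Nat.find_spec htend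
    have hl0 : l ≠ 0 := by
      intro h
      rw [h] at hl
      exact absurd hl (by simpa using hlt)
    obtain ⟨j, hj⟩ := Nat.exists_eq_succ_of_ne_zero hl0
    have hj' : ENNReal.ofReal t < dySum b (k + j) (dyPar^[j] m) :=
      not_le.1 (Nat.find_min htend (show j < l by omega))
    rw [hj, Function.iterate_succ_apply'] at hl
    have hmem : t ∈ T (k + j, dyPar^[j] m) := by
      refine ⟨?_, hj'⟩
      simpa [add_assoc] using hl
    refine mem_iUnion.2 ⟨(k + j, dyPar^[j] m), ?_⟩
    have hnear' : DyNear (dyPar^[j] m) (dyIdx (k + j) x) := by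
      rw [dyIdx_add]; exact hnear.iterate j
    rw [mem_ball]
    refine (dist_le_of_dyNear hnear').trans_lt ?_
    simp only [r, hmem, if_true]
    push_cast
    have : (0 : ℝ) < 2 ^ (k + (j : ℤ)) := by positivity
    linarith
  calc _ ≤ ∫⁻ t in Ioi (0 : ℝ), ∑' q : ℤ × (Fin n → ℤ),
        (T q).indicator (fun _ => (2 * n + 1 : ℝ≥0∞) ^ d * 2 ^ (q.1 * d)) t :=
        setLIntegral_mono' measurableSet_Ioi key
    _ = ∑' q : ℤ × (Fin n → ℤ), (2 * n + 1) ^ d * 2 ^ (q.1 * d) *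
          volume.restrict (Ioi (0 : ℝ)) (T q) := by
        rw [lintegral_tsum fun q => (measurable_const.indicator (hTm q)).aemeasurable]
        refine tsum_congr fun q => ?_
        rw [lintegral_indicator_const (hTm q)]
    _ ≤ ∑' q : ℤ × (Fin n → ℤ), (2 * n + 1) ^ d * (b q.1 q.2 * 2 ^ (q.1 * d)) := by
        refine ENNReal.tsum_le_tsum fun q => ?_
        rw [mul_assoc, mul_comm (b q.1 q.2)]
        gcongr
        exact hTv q
    _ = _ := by
        rw [ENNReal.tsum_mul_left, ENNReal.tsum_prod']

theorem hContent_mono {n : ℕ} {d : ℝ} {E F : Set (EuclideanSpace ℝ (Fin n))} (h : E ⊆ F) :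
    hContent n d E ≤ hContent n d F :=
  iInf_mono fun _ => iInf_mono fun _ => iInf_mono' fun hF => ⟨h.trans hF, le_rfl⟩

theorem measurable_dyIdx {n : ℕ} (k : ℤ) : Measurable (dyIdx (n := n) k) := by
  unfold dyIdx
  fun_prop

theorem measurableSet_dyCube {n : ℕ} (k : ℤ) (m : Fin n → ℤ) : MeasurableSet (dyCube k m) :=
  measurable_dyIdx k (measurableSet_singleton m)

theorem volume_dyCube_le {n : ℕ} (k : ℤ) (m : Fin n → ℤ) :
    volume (dyCube k m) ≤ 2 ^ ((k : ℝ) * n) := by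
  have hk : (0 : ℝ) < 2 ^ k := by positivity
  have hsub : dyCube k m ⊆ WithLp.ofLp ⁻¹'
      (Set.pi univ fun i => Ico ((m i : ℝ) * 2 ^ k) ((m i + 1) * 2 ^ k)) := by
    intro x hx i _
    have hxi : ⌊x i / 2 ^ k⌋ = m i := congrFun hx i
    have h2 := Int.floor_le (x i / 2 ^ k)
    have h3 := Int.lt_floor_add_one (x i / 2 ^ k)
    rw [hxi] at h2 h3
    exact ⟨(le_div_iff₀ hk).1 h2, (div_lt_iff₀ hk).1 h3⟩
  refine (measure_mono hsub).trans ?_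
  have hv := (PiLp.volume_preserving_ofLp (Fin n)).measure_preimage
    (MeasurableSet.univ_pi fun i => measurableSet_Ico
      (a := (m i : ℝ) * 2 ^ k) (b := (m i + 1) * 2 ^ k)).nullMeasurableSet
  rw [hv, Real.volume_pi_Ico]
  have h1 : ∀ i, ENNReal.ofReal ((m i + 1 : ℝ) * 2 ^ k - m i * 2 ^ k) = 2 ^ (k : ℝ) := by
    intro i
    rw [← coe_two_zpow]
    rw [show (m i + 1 : ℝ) * 2 ^ k - m i * 2 ^ k = ((2 ^ k : ℝ≥0) : ℝ) by push_cast; ring]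
    exact ENNReal.ofReal_coe_nnreal
  rw [Finset.prod_congr rfl fun i _ => h1 i]
  simp [ENNReal.rpow_mul]

theorem ball_subset_dyCube {n : ℕ} {k : ℤ} {r : ℝ} (hr : r ≤ 2 ^ k)
    (x : EuclideanSpace ℝ (Fin n)) :
    ball x r ⊆ ⋃ m ∈ Finset.Icc (dyIdx k x - 1) (dyIdx k x + 1), dyCube k m := by
  intro y hy
  have hk : (0 : ℝ) < 2 ^ k := by positivity
  have key : ∀ i, dyIdx k y i ≤ dyIdx k x i + 1 ∧ dyIdx k x i ≤ dyIdx k y i + 1 := by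
    intro i
    have h1 : |y i - x i| < 2 ^ k := by
      have := PiLp.norm_apply_le (y - x) i
      rw [← dist_eq_norm y x, PiLp.sub_apply, Real.norm_eq_abs] at this
      exact this.trans_lt ((mem_ball.1 hy).trans_le hr)
    rw [abs_lt] at h1
    simp only [dyIdx]
    constructor
    · rw [← Int.floor_add_one]
      refine Int.floor_le_floor ?_
      rw [div_add_one hk.ne', div_le_div_iff_of_pos_right hk]
      linarith
    · rw [← Int.floor_add_one]
      refine Int.floor_le_floor ?_
      rw [div_add_one hk.ne', div_le_div_iff_of_pos_right hk]
      linarith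
  simp only [mem_iUnion, Finset.mem_Icc]
  refine ⟨dyIdx k y, ⟨fun i => ?_, fun i => ?_⟩, rfl⟩
  · have := (key i).2
    simp only [Pi.sub_apply, Pi.one_apply]; omega
  · exact (key i).1

theorem dyNear_of_mem_Icc {n : ℕ} {m m' : Fin n → ℤ} (h : m ∈ Finset.Icc (m' - 1) (m' + 1)) :
    DyNear m m' := by
  intro i
  rw [Finset.mem_Icc] at h
  have h1 := h.1 i
  have h2 := h.2 i
  simp only [Pi.sub_apply, Pi.add_apply, Pi.one_apply] at h1 h2
  rw [abs_le]
  omega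

theorem card_Icc_near {n : ℕ} (m : Fin n → ℤ) : (Finset.Icc (m - 1) (m + 1)).card = 3 ^ n := by
  rw [Pi.card_Icc]
  have : ∀ i, (Finset.Icc ((m - 1) i) ((m + 1) i)).card = 3 := by
    intro i
    rw [Int.card_Icc]
    simp only [Pi.sub_apply, Pi.add_apply, Pi.one_apply]
    omega
  rw [Finset.prod_congr rfl fun i _ => this i]
  simp

theorem exists_two_zpow_bracket {r : ℝ} (hr : 0 < r) : ∃ k : ℤ, r ≤ 2 ^ k ∧ (2 : ℝ) ^ k < 2 * r := by
  obtain ⟨k, h1, h2⟩ := exists_mem_Ioc_zpow hr (one_lt_two)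
  refine ⟨k + 1, h2, ?_⟩
  rw [zpow_add_one₀ (by norm_num)]
  linarith

theorem ofReal_two_zpow (k : ℤ) : ENNReal.ofReal ((2 : ℝ) ^ k) = 2 ^ (k : ℝ) := by
  rw [← coe_two_zpow, ← ENNReal.ofReal_coe_nnreal]
  simp

theorem exists_lt_of_lt_fracMaximal {n : ℕ} {κ : ℝ} (hκn : κ < n)
    {f : EuclideanSpace ℝ (Fin n) → ℝ} {x : EuclideanSpace ℝ (Fin n)} {s : ℝ≥0∞}
    (h : s < fracMaximal n κ f x) :
    ∃ (k : ℤ) (m : _), DyNear m (dyIdx k x) ∧ s < 2 ^ (n - κ) * 3 ^ n *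
      (2 ^ ((k : ℝ) * (κ - n)) * ∫⁻ y in dyCube k m, ENNReal.ofReal |f y|) := by
  simp only [fracMaximal, lt_iSup_iff] at h
  obtain ⟨r, hr, h⟩ := h
  obtain ⟨k, hk1, hk2⟩ := exists_two_zpow_bracket hr
  by_contra! hcon
  refine absurd h (not_lt.2 ?_)
  have h1 : ENNReal.ofReal (r ^ (κ - n)) ≤ 2 ^ (n - κ) * 2 ^ ((k : ℝ) * (κ - n)) := by
    calc ENNReal.ofReal (r ^ (κ - n))
        ≤ ENNReal.ofReal (((2 : ℝ) ^ k / 2) ^ (κ - n)) := by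
          refine ENNReal.ofReal_le_ofReal ?_
          exact Real.rpow_le_rpow_of_nonpos (by positivity) (by linarith) (by linarith)
      _ = ENNReal.ofReal ((2 : ℝ) ^ k / 2) ^ (κ - n) :=
          (ENNReal.ofReal_rpow_of_pos (by positivity)).symm
      _ = _ := by
          rw [ENNReal.ofReal_div_of_pos two_pos, ofReal_two_zpow, ENNReal.ofReal_ofNat,
            div_eq_mul_inv, ENNReal.mul_rpow_of_ne_top, ← ENNReal.rpow_neg_one,
            ← ENNReal.rpow_mul, ← ENNReal.rpow_mul, mul_comm]
          · ring_nf
          · exact ENNReal.rpow_ne_top_of_ne_zero (by norm_num) (by norm_num)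
          · simp
  have h2 : ∫⁻ y in ball x r, ENNReal.ofReal |f y| ≤
      ∑ m ∈ Finset.Icc (dyIdx k x - 1) (dyIdx k x + 1),
        ∫⁻ y in dyCube k m, ENNReal.ofReal |f y| :=
    (lintegral_mono_set (ball_subset_dyCube hk1 x)).trans (by
      simp_rw [← Finset.mem_coe]
      rw [biUnion_eq_iUnion]
      refine (lintegral_iUnion_le _ _).trans_eq ?_
      exact Finset.tsum_subtype (Finset.Icc (dyIdx k x - 1) (dyIdx k x + 1))
        fun m => ∫⁻ y in dyCube k m, ENNReal.ofReal |f y|)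
  have h3 : (2 : ℝ≥0∞) ^ (n - κ) * 2 ^ ((k : ℝ) * (κ - n)) * ((3 : ℝ≥0∞) ^ n *
      ∑ m ∈ Finset.Icc (dyIdx k x - 1) (dyIdx k x + 1),
        ∫⁻ y in dyCube k m, ENNReal.ofReal |f y|) ≤ 3 ^ n * s := by
    calc _ = ∑ m ∈ Finset.Icc (dyIdx k x - 1) (dyIdx k x + 1), 2 ^ (n - κ) * 3 ^ n *
      (2 ^ ((k : ℝ) * (κ - n)) * ∫⁻ y in dyCube k m, ENNReal.ofReal |f y|) := by
          rw [Finset.mul_sum, Finset.mul_sum]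
          refine Finset.sum_congr rfl fun m _ => by ring
      _ ≤ ∑ m ∈ Finset.Icc (dyIdx k x - 1) (dyIdx k x + 1), s :=
          Finset.sum_le_sum fun m hm => hcon k m (dyNear_of_mem_Icc hm)
      _ = _ := by rw [Finset.sum_const, card_Icc_near]; simp
  have h4 : (3 : ℝ≥0∞) ^ n * (ENNReal.ofReal (r ^ (κ - n)) *
      ∫⁻ y in ball x r, ENNReal.ofReal |f y|) ≤ 3 ^ n * s := by
    refine le_trans ?_ h3
    rw [mul_left_comm]
    gcongr
  exact (ENNReal.mul_le_mul_iff_right (by positivity) (by finiteness)).1 h4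

theorem echoquet_fracMaximal_le {n : ℕ} (hn0 : 0 < n) {κ p d : ℝ} (hκn : κ < n) (hp : 0 < p)
    (hd : 0 < d) (f : EuclideanSpace ℝ (Fin n) → ℝ) (b : ℤ → (Fin n → ℤ) → ℝ≥0∞)
    (hb : ∀ (k : ℤ) m, (2 ^ ((k : ℝ) * (κ - n)) * ∫⁻ y in dyCube k m, ENNReal.ofReal |f y|) ^ p
      ≤ dySum b k m) :
    echoquet n d univ (fun x => fracMaximal n κ f x ^ p) ≤
      (2 * n + 1) ^ d * (2 ^ (n - κ) * 3 ^ n) ^ p *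
        ∑' (k : ℤ) (m), b k m * 2 ^ ((k : ℝ) * d) := by
  set C : ℝ≥0∞ := (2 ^ (n - κ) * 3 ^ n) ^ p with hC
  calc echoquet n d univ (fun x => fracMaximal n κ f x ^ p)
      ≤ ∫⁻ t in Ioi (0 : ℝ), hContent n d
        {x | ∃ k m, DyNear m (dyIdx k x) ∧
          ENNReal.ofReal t < dySum (fun k m => C * b k m) k m} := by
        unfold echoquet
        refine lintegral_mono fun t => ?_
        refine hContent_mono ?_
        rintro x ⟨-, hx⟩
        have h1 : ENNReal.ofReal t ^ (1 / p) < fracMaximal n κ f x := by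
          rw [one_div]
          exact (ENNReal.rpow_inv_lt_iff hp).2 hx
        obtain ⟨k, m, hm, h⟩ := exists_lt_of_lt_fracMaximal hκn h1
        refine ⟨k, m, hm, ?_⟩
        rw [one_div, ENNReal.rpow_inv_lt_iff hp, ENNReal.mul_rpow_of_nonneg _ _ hp.le] at h
        refine h.trans_le ?_
        have : dySum (fun k m => C * b k m) k m = C * dySum b k m := ENNReal.tsum_mul_left
        rw [this]
        gcongr
        exact hb k m
    _ ≤ (2 * n + 1) ^ d * ∑' (k : ℤ) (m), C * b k m * 2 ^ (k * d) :=
        lintegral_hContent_dySum_le hn0 hd _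
    _ = _ := by simp_rw [mul_assoc, ENNReal.tsum_mul_left]

theorem tsum_int_ge (k : ℤ) (f : ℤ → ℝ≥0∞) :
    ∑' j, (if k ≤ j then f j else 0) = ∑' l : ℕ, f (k + l) := by
  have hinj : Function.Injective fun l : ℕ => k + (l : ℤ) := fun a b h => by simpa using h
  rw [← hinj.tsum_eq]
  · exact tsum_congr fun l => by simp
  · intro j hj
    have hkj : k ≤ j := by
      by_contra h
      simp [h] at hj
    exact ⟨(j - k).toNat, by simp [hkj]⟩

theorem tsum_two_rpow_ne_top {s : ℝ} (hs : 0 < s) :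
    ∑' l : ℕ, (2 : ℝ≥0∞) ^ (-((l : ℝ) * s)) ≠ ⊤ := by
  have h : ∀ l : ℕ, (2 : ℝ≥0∞) ^ (-((l : ℝ) * s)) = (2 ^ (-s)) ^ l := by
    intro l
    rw [← ENNReal.rpow_natCast, ← ENNReal.rpow_mul]
    ring_nf
  simp_rw [h, ENNReal.tsum_geometric]
  have h1 : (2 : ℝ≥0∞) ^ (-s) < 1 := ENNReal.rpow_lt_one_of_one_lt_of_neg (by norm_num) (by linarith)
  simpa [tsub_eq_zero_iff_le] using h1

theorem rpow_tsum_le_tsum_rpow {ι : Type*} {p : ℝ} (hp0 : 0 < p) (hp1 : p ≤ 1) (f : ι → ℝ≥0∞) :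
    (∑' i, f i) ^ p ≤ ∑' i, f i ^ p := by
  classical
  have h : ∀ s : Finset ι, (∑ i ∈ s, f i) ^ p ≤ ∑ i ∈ s, f i ^ p := by
    intro s
    induction s using Finset.induction_on with
    | empty => simp [hp0]
    | insert i s hi ih =>
      rw [Finset.sum_insert hi, Finset.sum_insert hi]
      exact (ENNReal.rpow_add_le_add_rpow _ _ hp0.le hp1).trans (by gcongr)
  rw [← ENNReal.le_rpow_inv_iff hp0, ENNReal.tsum_eq_iSup_sum]
  refine iSup_le fun s => ?_
  rw [ENNReal.le_rpow_inv_iff hp0]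
  exact (h s).trans (ENNReal.sum_le_tsum s)

theorem tsum_dyadic_le_lintegral {F : ℝ → ℝ≥0∞} (hF : Antitone F) :
    ∑' j : ℤ, (2 : ℝ≥0∞) ^ (j : ℝ) * F (2 ^ j) ≤ 2 * ∫⁻ t in Ioi (0 : ℝ), F t := by
  let A : ℤ → Set ℝ := fun j => Ioc (2 ^ (j - 1)) (2 ^ (Order.succ j - 1))
  have hA : Pairwise (Function.onFun Disjoint A) :=
    Monotone.pairwise_disjoint_on_Ioc_succ (f := fun j : ℤ => (2 : ℝ) ^ (j - 1))
      fun a b h => zpow_le_zpow_right₀ one_le_two (by omega)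
  have h1 : ∀ j : ℤ, (2 : ℝ≥0∞) ^ (j : ℝ) * F (2 ^ j) ≤ 2 * ∫⁻ t in A j, F t := by
    intro j
    have hv : volume (A j) = 2 ^ ((j - 1 : ℤ) : ℝ) := by
      simp only [A, Real.volume_Ioc, ← ofReal_two_zpow, Order.succ_eq_add_one]
      congr 1
      rw [show j + 1 - 1 = (j - 1) + 1 by ring, zpow_add_one₀ (by norm_num)]
      ring
    calc (2 : ℝ≥0∞) ^ (j : ℝ) * F (2 ^ j) = 2 * ∫⁻ _ in A j, F (2 ^ j) := by
          rw [setLIntegral_const, hv, mul_left_comm, mul_comm]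
          congr 1
          rw [show (j : ℝ) = 1 + ((j - 1 : ℤ) : ℝ) by push_cast; ring,
            ENNReal.rpow_add _ _ (by norm_num) (by norm_num), ENNReal.rpow_one]
      _ ≤ 2 * ∫⁻ t in A j, F t := by
          gcongr 2 * ?_
          refine setLIntegral_mono' measurableSet_Ioc fun t ht => hF ?_
          simpa [A] using ht.2
  calc _ ≤ ∑' j, 2 * ∫⁻ t in A j, F t := ENNReal.tsum_le_tsum h1
    _ = 2 * ∫⁻ t in ⋃ j, A j, F t := by
        rw [ENNReal.tsum_mul_left, lintegral_iUnion (fun j => measurableSet_Ioc) hA]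
    _ ≤ _ := by
        gcongr
        refine iUnion_subset fun j t ht => ?_
        exact lt_trans (by positivity) ht.1

theorem antitone_hContent_superlevel {n : ℕ} {d : ℝ} (u : EuclideanSpace ℝ (Fin n) → ℝ) :
    Antitone fun t => hContent n d {x ∈ univ | t < u x} :=
  fun _ _ h => hContent_mono fun _ hx => ⟨hx.1, h.trans_lt hx.2⟩

theorem exists_dyadic_weights {n : ℕ} {d : ℝ} (hd : 0 < d)
    (u : EuclideanSpace ℝ (Fin n) → ℝ) (hu : choquet n d univ u ≠ ⊤) {ε : ℝ≥0∞} (hε : ε ≠ 0) :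
    ∃ a : ℤ → (Fin n → ℤ) → ℝ≥0∞,
      (∀ x, 0 < u x → ∃ k, ENNReal.ofReal (u x) ≤ a k (dyIdx k x)) ∧
      ∑' (k : ℤ) (m), a k m * 2 ^ ((k : ℝ) * d) ≤
        3 ^ n * 2 ^ d * (4 * choquet n d univ u + ε) := by
  classical
  let F : ℤ → ℝ≥0∞ := fun j => hContent n d {x ∈ univ | (2 : ℝ) ^ j < u x}
  have hFsum : ∑' j : ℤ, (2 : ℝ≥0∞) ^ (j : ℝ) * F j ≤ 2 * choquet n d univ u :=
    tsum_dyadic_le_lintegral (antitone_hContent_superlevel u)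
  have hpos : ∀ s : ℝ, (2 : ℝ≥0∞) ^ s ≠ 0 := fun s =>
    (ENNReal.rpow_pos (by norm_num) (by norm_num)).ne'
  have hF : ∀ j, F j ≠ ⊤ := by
    intro j hj
    have h1 := (ENNReal.le_tsum j).trans hFsum
    rw [hj, ENNReal.mul_top (hpos _), top_le_iff] at h1
    exact ENNReal.mul_ne_top (by norm_num) hu h1
  obtain ⟨ε', hε'0, hε'⟩ := ENNReal.exists_pos_sum_of_countable' hε ℤ
  have hcov : ∀ j : ℤ, ∃ (x : ℕ → EuclideanSpace ℝ (Fin n)) (r : ℕ → ℝ≥0),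
      {x ∈ univ | (2 : ℝ) ^ j < u x} ⊆ ⋃ i, ball (x i) (r i) ∧
      ∑' i, (r i : ℝ≥0∞) ^ d ≤ F j + ε' j * 2 ^ (-((j : ℝ) + 1)) := by
    intro j
    have h1 : F j < F j + ε' j * 2 ^ (-((j : ℝ) + 1)) :=
      ENNReal.lt_add_right (hF j) (mul_ne_zero (hε'0 j).ne' (hpos _))
    conv_lhs at h1 => simp only [F]
    unfold hContent at h1
    simp only [iInf_lt_iff] at h1
    obtain ⟨x, r, h2, h3⟩ := h1
    exact ⟨x, r, h2, h3.le⟩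
  choose x r hxr hr using hcov
  choose! K hK using fun (r : ℝ) (h : 0 < r) => exists_two_zpow_bracket h
  let P : ℤ × (Fin n → ℤ) → ℤ × ℕ → Prop := fun q s =>
    0 < r s.1 s.2 ∧ q.1 = K (r s.1 s.2) ∧
      q.2 ∈ Finset.Icc (dyIdx q.1 (x s.1 s.2) - 1) (dyIdx q.1 (x s.1 s.2) + 1)
  let w : ℤ × (Fin n → ℤ) → ℤ × ℕ → ℝ≥0∞ := fun q s => if P q s then 2 ^ ((s.1 : ℝ) + 1) else 0
  refine ⟨fun k m => ∑' s : ℤ × ℕ, w (k, m) s, ?_, ?_⟩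
  · intro y hy
    obtain ⟨j, hj1, hj2⟩ := exists_mem_Ioc_zpow hy one_lt_two
    obtain ⟨i, hi⟩ := mem_iUnion.1 (hxr j ⟨mem_univ _, hj1⟩)
    have hri : (0 : ℝ) < r j i := pos_of_mem_ball hi
    refine ⟨K (r j i), ?_⟩
    obtain ⟨m, hm, hym⟩ := mem_iUnion₂.1 (ball_subset_dyCube (hK _ hri).1 _ hi)
    have hym' : dyIdx (K (r j i)) y = m := hym
    have hP : P (K (r j i), dyIdx (K (r j i)) y) (j, i) :=
      ⟨by exact_mod_cast hri, rfl, by rw [hym']; exact hm⟩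
    refine le_trans ?_ (ENNReal.le_tsum (j, i))
    simp only [w, hP, if_true]
    refine (ENNReal.ofReal_le_ofReal hj2).trans ?_
    rw [ofReal_two_zpow]
    push_cast
    exact le_rfl
  · have hin : ∀ s : ℤ × ℕ, ∑' q : ℤ × (Fin n → ℤ), w q s * 2 ^ ((q.1 : ℝ) * d) ≤
        3 ^ n * 2 ^ d * (2 ^ ((s.1 : ℝ) + 1) * (r s.1 s.2 : ℝ≥0∞) ^ d) := by
      intro s
      by_cases hrs : 0 < r s.1 s.2
      · have hrs' : (0 : ℝ) < r s.1 s.2 := by exact_mod_cast hrs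
        rw [ENNReal.tsum_prod', tsum_eq_single (K (r s.1 s.2))]
        · rw [tsum_eq_sum (s := Finset.Icc (dyIdx (K (r s.1 s.2)) (x s.1 s.2) - 1)
            (dyIdx (K (r s.1 s.2)) (x s.1 s.2) + 1))]
          · calc _ ≤ ∑ m ∈ Finset.Icc (dyIdx (K (r s.1 s.2)) (x s.1 s.2) - 1)
                    (dyIdx (K (r s.1 s.2)) (x s.1 s.2) + 1),
                    (2 : ℝ≥0∞) ^ ((s.1 : ℝ) + 1) * (2 ^ d * (r s.1 s.2 : ℝ≥0∞) ^ d) := by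
                  refine Finset.sum_le_sum fun m hm => ?_
                  have h2 : (2 : ℝ≥0∞) ^ ((K (r s.1 s.2) : ℝ) * d) ≤
                      2 ^ d * (r s.1 s.2 : ℝ≥0∞) ^ d := by
                    rw [← ENNReal.mul_rpow_of_nonneg _ _ hd.le, ENNReal.rpow_mul]
                    refine ENNReal.rpow_le_rpow ?_ hd.le
                    rw [← ofReal_two_zpow, ← ENNReal.ofReal_coe_nnreal, ← ENNReal.ofReal_ofNat,
                      ← ENNReal.ofReal_mul (by norm_num)]
                    exact ENNReal.ofReal_le_ofReal (hK _ hrs').2.le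
                  refine mul_le_mul' ?_ h2
                  simp only [w]
                  split_ifs <;> simp
              _ = _ := by
                  rw [Finset.sum_const, card_Icc_near]
                  simp only [nsmul_eq_mul]
                  push_cast
                  ring
          · intro m hm
            have : ¬ P (K (r s.1 s.2), m) s := fun h => hm h.2.2
            simp [w, this]
        · intro k hk
          refine ENNReal.tsum_eq_zero.2 fun m => ?_
          have : ¬ P (k, m) s := fun h => hk h.2.1
          simp [w, this]
      · have : ∀ q, ¬ P q s := fun q h => hrs h.1
        simp [w, this]
    calc ∑' (k : ℤ) (m), (∑' s : ℤ × ℕ, w (k, m) s) * 2 ^ ((k : ℝ) * d)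
        = ∑' q : ℤ × (Fin n → ℤ), ∑' s : ℤ × ℕ, w q s * 2 ^ ((q.1 : ℝ) * d) := by
          rw [ENNReal.tsum_prod']
          simp_rw [ENNReal.tsum_mul_right]
      _ = ∑' s : ℤ × ℕ, ∑' q : ℤ × (Fin n → ℤ), w q s * 2 ^ ((q.1 : ℝ) * d) := ENNReal.tsum_comm
      _ ≤ ∑' s : ℤ × ℕ, 3 ^ n * 2 ^ d * (2 ^ ((s.1 : ℝ) + 1) * (r s.1 s.2 : ℝ≥0∞) ^ d) :=
          ENNReal.tsum_le_tsum hin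
      _ = 3 ^ n * 2 ^ d * ∑' j : ℤ, 2 ^ ((j : ℝ) + 1) * ∑' i, (r j i : ℝ≥0∞) ^ d := by
          rw [ENNReal.tsum_mul_left, ENNReal.tsum_prod']
          simp_rw [ENNReal.tsum_mul_left]
      _ ≤ 3 ^ n * 2 ^ d * ∑' j : ℤ, (2 * (2 ^ (j : ℝ) * F j) + ε' j) := by
          gcongr with j
          refine (mul_le_mul_right (hr j) _).trans_eq ?_
          rw [mul_add, mul_left_comm _ (ε' j), ← ENNReal.rpow_add _ _ (by norm_num) (by norm_num),
            add_neg_cancel, ENNReal.rpow_zero, mul_one,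
            ENNReal.rpow_add _ _ (by norm_num) (by norm_num), ENNReal.rpow_one]
          ring
      _ ≤ _ := by
          rw [ENNReal.tsum_add, ENNReal.tsum_mul_left]
          exact mul_le_mul_right (add_le_add
            ((mul_le_mul_right hFsum 2).trans_eq (by ring)) hε'.le) _

theorem iterate_dyPar_of_inter {n : ℕ} {k : ℤ} {l : ℕ} {m m' : Fin n → ℤ}
    {x : EuclideanSpace ℝ (Fin n)} (hx : x ∈ dyCube k m) (hx' : x ∈ dyCube (k + l) m') :
    m' = dyPar^[l] m := by
  have h1 : dyIdx k x = m := hx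
  have h2 : dyIdx (k + l) x = m' := hx'
  rw [← h1, ← h2, dyIdx_add]

theorem lintegral_dyCube_rpow_le {n : ℕ} {p : ℝ} (hp0 : 0 < p) (hp1 : p ≤ 1)
    {g : EuclideanSpace ℝ (Fin n) → ℝ≥0∞} {a : ℤ → (Fin n → ℤ) → ℝ≥0∞}
    (hg : ∀ x, 0 < g x → ∃ k, g x ^ p ≤ a k (dyIdx k x)) (E : Set (EuclideanSpace ℝ (Fin n))) :
    (∫⁻ y in E, g y) ^ p ≤ ∑' (j : ℤ) (m), a j m * volume (E ∩ dyCube j m) ^ p := by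
  have h1 : ∀ y, g y ≤ ∑' q : ℤ × (Fin n → ℤ),
      (dyCube q.1 q.2).indicator (fun _ => a q.1 q.2 ^ p⁻¹) y := by
    intro y
    rcases eq_or_ne (g y) 0 with h | h
    · simp [h]
    · obtain ⟨k, hk⟩ := hg y (pos_iff_ne_zero.2 h)
      refine le_trans ?_ (ENNReal.le_tsum (k, dyIdx k y))
      rw [indicator_of_mem (show y ∈ dyCube k (dyIdx k y) from rfl)]
      exact (ENNReal.le_rpow_inv_iff hp0).2 hk
  calc (∫⁻ y in E, g y) ^ p
      ≤ (∑' q : ℤ × (Fin n → ℤ), a q.1 q.2 ^ p⁻¹ * volume (E ∩ dyCube q.1 q.2)) ^ p := by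
        refine ENNReal.rpow_le_rpow ?_ hp0.le
        refine (lintegral_mono h1).trans_eq ?_
        have hm : ∀ q : ℤ × (Fin n → ℤ), AEMeasurable
            ((dyCube q.1 q.2).indicator fun _ => a q.1 q.2 ^ p⁻¹) (volume.restrict E) := fun q =>
          (measurable_const.indicator (measurableSet_dyCube q.1 q.2)).aemeasurable
        rw [lintegral_tsum hm]
        refine tsum_congr fun q => ?_
        rw [lintegral_indicator_const (measurableSet_dyCube q.1 q.2),
          Measure.restrict_apply (measurableSet_dyCube q.1 q.2), inter_comm]
    _ ≤ ∑' q : ℤ × (Fin n → ℤ), (a q.1 q.2 ^ p⁻¹ * volume (E ∩ dyCube q.1 q.2)) ^ p :=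
        rpow_tsum_le_tsum_rpow hp0 hp1 _
    _ = _ := by
        rw [ENNReal.tsum_prod']
        refine tsum_congr fun j => tsum_congr fun m => ?_
        rw [ENNReal.mul_rpow_of_nonneg _ _ hp0.le, ENNReal.rpow_inv_rpow hp0.ne']

theorem tsum_tsum_comm {α β γ δ : Type*} (f : α → β → γ → δ → ℝ≥0∞) :
    ∑' (a) (b) (c) (d), f a b c d = ∑' (c) (d) (a) (b), f a b c d := by
  calc _ = ∑' (x : α × β) (y : γ × δ), f x.1 x.2 y.1 y.2 := by
        simp_rw [ENNReal.tsum_prod']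
    _ = ∑' (y : γ × δ) (x : α × β), f x.1 x.2 y.1 y.2 := ENNReal.tsum_comm
    _ = _ := by simp_rw [ENNReal.tsum_prod']

theorem two_rpow_mul (s t : ℝ) : (2 : ℝ≥0∞) ^ s * 2 ^ t = 2 ^ (s + t) :=
  (ENNReal.rpow_add _ _ (by norm_num) (by norm_num)).symm

theorem volume_dyCube_rpow_le {n : ℕ} {p : ℝ} (hp0 : 0 < p) (k : ℤ) (m : Fin n → ℤ) :
    volume (dyCube k m) ^ p ≤ 2 ^ ((k : ℝ) * n * p) := by
  rw [ENNReal.rpow_mul]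
  exact ENNReal.rpow_le_rpow (volume_dyCube_le k m) hp0.le

/-- The carrier of the weights at scales at most `k` inside the cube `(k, m)`. -/
noncomputable def innerWeight {n : ℕ} (κ p : ℝ) (a : ℤ → (Fin n → ℤ) → ℝ≥0∞) (k : ℤ)
    (m : Fin n → ℤ) : ℝ≥0∞ :=
  ∑' (j : ℤ) (m' : Fin n → ℤ), if j ≤ k then
    2 ^ ((k : ℝ) * (κ - n) * p) * (a j m' * volume (dyCube k m ∩ dyCube j m') ^ p) else 0

theorem rpow_average_le_dySum {n : ℕ} {κ p : ℝ} (hκ : 0 ≤ κ) (hp0 : 0 < p) (hp1 : p ≤ 1)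
    {g : EuclideanSpace ℝ (Fin n) → ℝ≥0∞} {a : ℤ → (Fin n → ℤ) → ℝ≥0∞}
    (hg : ∀ x, 0 < g x → ∃ k, g x ^ p ≤ a k (dyIdx k x)) (k : ℤ) (m : Fin n → ℤ) :
    (2 ^ ((k : ℝ) * (κ - n)) * ∫⁻ y in dyCube k m, g y) ^ p ≤
      dySum (fun k m => a k m * 2 ^ ((k : ℝ) * (κ * p)) + innerWeight κ p a k m) k m := by
  have hadd : dySum (fun k m => a k m * 2 ^ ((k : ℝ) * (κ * p)) + innerWeight κ p a k m) k m =
      dySum (fun k m => a k m * 2 ^ ((k : ℝ) * (κ * p))) k m + dySum (innerWeight κ p a) k m :=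
    ENNReal.tsum_add
  have hinner : innerWeight κ p a k m ≤ dySum (innerWeight κ p a) k m := by
    rw [dySum_succ]; exact le_self_add
  have houter : ∑' (j : ℤ) (m' : Fin n → ℤ), (if k ≤ j then
      2 ^ ((k : ℝ) * (κ - n) * p) * (a j m' * volume (dyCube k m ∩ dyCube j m') ^ p) else 0) ≤
      dySum (fun k m => a k m * 2 ^ ((k : ℝ) * (κ * p))) k m := by
    have h1 := tsum_int_ge k fun j => ∑' m' : Fin n → ℤ,
      2 ^ ((k : ℝ) * (κ - n) * p) * (a j m' * volume (dyCube k m ∩ dyCube j m') ^ p)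
    have h2 : ∀ j : ℤ, (∑' m' : Fin n → ℤ, (if k ≤ j then
      2 ^ ((k : ℝ) * (κ - n) * p) * (a j m' * volume (dyCube k m ∩ dyCube j m') ^ p) else 0)) =
      if k ≤ j then ∑' m' : Fin n → ℤ,
      2 ^ ((k : ℝ) * (κ - n) * p) * (a j m' * volume (dyCube k m ∩ dyCube j m') ^ p) else 0 := by
      intro j; split_ifs <;> simp
    simp_rw [h2]
    rw [h1]
    unfold dySum
    refine ENNReal.tsum_le_tsum fun l => ?_
    rw [tsum_eq_single (dyPar^[l] m)]
    · calc _ ≤ (2 : ℝ≥0∞) ^ ((k : ℝ) * (κ - n) * p) *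
            (a (k + l) (dyPar^[l] m) * 2 ^ ((k : ℝ) * n * p)) := by
            gcongr
            exact (ENNReal.rpow_le_rpow (measure_mono inter_subset_left) hp0.le).trans
              (volume_dyCube_rpow_le hp0 k m)
        _ = a (k + l) (dyPar^[l] m) * 2 ^ ((k : ℝ) * (κ * p)) := by
            rw [mul_left_comm, two_rpow_mul]
            ring_nf
        _ ≤ _ := by
            refine mul_le_mul_right (ENNReal.rpow_le_rpow_of_exponent_le (by norm_num) ?_) _
            have : (0 : ℝ) ≤ l * (κ * p) := by positivity
            push_cast
            linarith
    · intro m' hm'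
      have : dyCube k m ∩ dyCube (k + l) m' = ∅ := by
        refine eq_empty_of_forall_notMem fun x hx => hm' (iterate_dyPar_of_inter hx.1 hx.2)
      simp [this, hp0]
  rw [hadd]
  refine le_trans ?_ (add_le_add houter hinner)
  rw [innerWeight, ENNReal.mul_rpow_of_nonneg _ _ hp0.le, ← ENNReal.rpow_mul, ← ENNReal.tsum_add]
  refine (mul_le_mul_right (lintegral_dyCube_rpow_le hp0 hp1 hg _) _).trans ?_
  rw [← ENNReal.tsum_mul_left]
  refine ENNReal.tsum_le_tsum fun j => ?_
  rw [← ENNReal.tsum_mul_left, ← ENNReal.tsum_add]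
  refine ENNReal.tsum_le_tsum fun m' => ?_
  rcases le_total k j with h | h
  · simp [h]
  · simp [h]

theorem tsum_innerWeight_le {n : ℕ} {κ p δ : ℝ} (hp0 : 0 < p)
    (a : ℤ → (Fin n → ℤ) → ℝ≥0∞) :
    ∑' (k : ℤ) (m), innerWeight κ p a k m * 2 ^ ((k : ℝ) * (δ - κ * p)) ≤
      (∑' l : ℕ, 2 ^ (-((l : ℝ) * (n * p - δ)))) * ∑' (k : ℤ) (m), a k m * 2 ^ ((k : ℝ) * δ) := by
  have hvol : ∀ (j : ℤ) (m' : Fin n → ℤ) (l : ℕ),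
      ∑' m, volume (dyCube (j + l) m ∩ dyCube j m') ^ p ≤ 2 ^ ((j : ℝ) * n * p) := by
    intro j m' l
    rw [tsum_eq_single (dyPar^[l] m')]
    · exact (ENNReal.rpow_le_rpow (measure_mono inter_subset_right) hp0.le).trans
        (volume_dyCube_rpow_le hp0 j m')
    · intro m hm
      have : dyCube (j + l) m ∩ dyCube j m' = ∅ := by
        refine eq_empty_of_forall_notMem fun x hx => hm (iterate_dyPar_of_inter hx.2 hx.1)
      simp [this, hp0]
  have key : ∀ (j : ℤ) (m' : Fin n → ℤ), (∑' k : ℤ, if j ≤ k then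
      ∑' m, 2 ^ ((k : ℝ) * (δ - n * p)) * (a j m' * volume (dyCube k m ∩ dyCube j m') ^ p) else 0)
      ≤ (∑' l : ℕ, 2 ^ (-((l : ℝ) * (n * p - δ)))) * (a j m' * 2 ^ ((j : ℝ) * δ)) := by
    intro j m'
    rw [tsum_int_ge j fun k => ∑' m, 2 ^ ((k : ℝ) * (δ - n * p)) *
      (a j m' * volume (dyCube k m ∩ dyCube j m') ^ p), ← ENNReal.tsum_mul_right]
    refine ENNReal.tsum_le_tsum fun l => ?_
    simp_rw [ENNReal.tsum_mul_left]
    refine (mul_le_mul_right (mul_le_mul_right (hvol j m' l) _) _).trans_eq ?_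
    rw [mul_left_comm, two_rpow_mul, mul_left_comm, two_rpow_mul]
    push_cast
    ring_nf
  calc _ = ∑' (k : ℤ) (m) (j : ℤ) (m' : Fin n → ℤ), (if j ≤ k then
        2 ^ ((k : ℝ) * (δ - n * p)) * (a j m' * volume (dyCube k m ∩ dyCube j m') ^ p) else 0) := by
        refine tsum_congr fun k => tsum_congr fun m => ?_
        rw [innerWeight, ← ENNReal.tsum_mul_right]
        refine tsum_congr fun j => ?_
        rw [← ENNReal.tsum_mul_right]
        refine tsum_congr fun m' => ?_
        split_ifs
        · rw [mul_right_comm, two_rpow_mul]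
          ring_nf
        · simp
    _ = ∑' (j : ℤ) (m' : Fin n → ℤ) (k : ℤ) (m), (if j ≤ k then
        2 ^ ((k : ℝ) * (δ - n * p)) * (a j m' * volume (dyCube k m ∩ dyCube j m') ^ p) else 0) := by
        exact tsum_tsum_comm _
    _ ≤ ∑' (j : ℤ) (m' : Fin n → ℤ), (∑' l : ℕ, 2 ^ (-((l : ℝ) * (n * p - δ)))) *
        (a j m' * 2 ^ ((j : ℝ) * δ)) := by
        refine ENNReal.tsum_le_tsum fun j => ENNReal.tsum_le_tsum fun m' => ?_
        refine le_trans (le_of_eq ?_) (key j m')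
        refine tsum_congr fun k => ?_
        split_ifs <;> simp
    _ = _ := by simp_rw [ENNReal.tsum_mul_left]

theorem rpow_average_le_average_rpow {n : ℕ} {κ p : ℝ} (hp : 1 ≤ p)
    {f : EuclideanSpace ℝ (Fin n) → ℝ} (hf : AEStronglyMeasurable f volume) (k : ℤ)
    (m : Fin n → ℤ) :
    (2 ^ ((k : ℝ) * (κ - n)) * ∫⁻ y in dyCube k m, ENNReal.ofReal |f y|) ^ p ≤
      2 ^ ((k : ℝ) * (κ * p - n)) * ∫⁻ y in dyCube k m, ENNReal.ofReal |f y| ^ p := by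
  have hp0 : 0 < p := by linarith
  have h1 := eLpNorm'_le_eLpNorm'_mul_rpow_measure_univ (p := 1) (q := p)
    (μ := volume.restrict (dyCube k m)) one_pos hp hf.restrict
  simp only [eLpNorm', ENNReal.rpow_one, div_one, Real.enorm_eq_ofReal_abs,
    Measure.restrict_apply_univ, one_div] at h1
  have h2 : (∫⁻ y in dyCube k m, ENNReal.ofReal |f y|) ^ p ≤
      (∫⁻ y in dyCube k m, ENNReal.ofReal |f y| ^ p) * 2 ^ ((k : ℝ) * n * (p - 1)) := by
    refine (ENNReal.rpow_le_rpow h1 hp0.le).trans ?_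
    rw [ENNReal.mul_rpow_of_nonneg _ _ hp0.le, ENNReal.rpow_inv_rpow hp0.ne', ← ENNReal.rpow_mul]
    gcongr
    rw [ENNReal.rpow_mul 2 ((k : ℝ) * n)]
    have : (1 - p⁻¹) * p = p - 1 := by field_simp
    rw [this]
    exact ENNReal.rpow_le_rpow (volume_dyCube_le k m) (by linarith)
  rw [ENNReal.mul_rpow_of_nonneg _ _ hp0.le]
  refine (mul_le_mul_right h2 _).trans_eq ?_
  rw [← ENNReal.rpow_mul, mul_left_comm, two_rpow_mul, mul_comm]
  ring_nf

theorem exists_weights_of_le_one {n : ℕ} {δ κ p : ℝ} (hδ : 0 < δ) (hκ : 0 ≤ κ) (hp0 : 0 < p)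
    (hp1 : p ≤ 1) (g : EuclideanSpace ℝ (Fin n) → ℝ≥0∞) (u : EuclideanSpace ℝ (Fin n) → ℝ)
    (hgu : ∀ x, g x ^ p = ENNReal.ofReal (u x)) (hu : choquet n δ univ u ≠ ⊤) {ε : ℝ≥0∞}
    (hε : ε ≠ 0) :
    ∃ b : ℤ → (Fin n → ℤ) → ℝ≥0∞,
      (∀ (k : ℤ) m, (2 ^ ((k : ℝ) * (κ - n)) * ∫⁻ y in dyCube k m, g y) ^ p ≤ dySum b k m) ∧
      ∑' (k : ℤ) (m), b k m * 2 ^ ((k : ℝ) * (δ - κ * p)) ≤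
        (1 + ∑' l : ℕ, 2 ^ (-((l : ℝ) * (n * p - δ)))) * (3 ^ n * 2 ^ δ) * 4 *
          (choquet n δ univ u + ε) := by
  obtain ⟨a, ha, hsum⟩ := exists_dyadic_weights hδ u hu hε
  have hg : ∀ x, 0 < g x → ∃ k, g x ^ p ≤ a k (dyIdx k x) := by
    intro x hx
    rw [hgu]
    refine ha x (ENNReal.ofReal_pos.1 ?_)
    rw [← hgu]
    exact ENNReal.rpow_pos_of_nonneg hx hp0.le
  refine ⟨_, fun k m => rpow_average_le_dySum hκ hp0 hp1 hg k m, ?_⟩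
  calc _ = ∑' (k : ℤ) (m), a k m * 2 ^ ((k : ℝ) * δ) +
        ∑' (k : ℤ) (m), innerWeight κ p a k m * 2 ^ ((k : ℝ) * (δ - κ * p)) := by
        simp_rw [← ENNReal.tsum_add]
        refine tsum_congr fun k => tsum_congr fun m => ?_
        rw [add_mul, mul_assoc, two_rpow_mul]
        ring_nf
    _ ≤ (1 + ∑' l : ℕ, 2 ^ (-((l : ℝ) * (n * p - δ)))) *
        ∑' (k : ℤ) (m), a k m * 2 ^ ((k : ℝ) * δ) := by
        rw [add_mul, one_mul]
        gcongr
        exact tsum_innerWeight_le hp0 a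
    _ ≤ (1 + ∑' l : ℕ, 2 ^ (-((l : ℝ) * (n * p - δ)))) *
        (3 ^ n * 2 ^ δ * (4 * choquet n δ univ u + ε)) := mul_le_mul_right hsum _
    _ ≤ (1 + ∑' l : ℕ, 2 ^ (-((l : ℝ) * (n * p - δ)))) *
        (3 ^ n * 2 ^ δ * (4 * choquet n δ univ u + 4 * ε)) := by
        gcongr
        exact le_mul_of_one_le_left zero_le (by norm_num)
    _ = _ := by ring

theorem volume_le_hContent {n : ℕ} (hn0 : 0 < n) (E : Set (EuclideanSpace ℝ (Fin n))) :
    volume E ≤ volume (ball (0 : EuclideanSpace ℝ (Fin n)) 1) * hContent n n E := by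
  have : Nonempty (Fin n) := ⟨⟨0, hn0⟩⟩
  have hb : volume (ball (0 : EuclideanSpace ℝ (Fin n)) 1) ≠ ⊤ := measure_ball_lt_top.ne
  unfold hContent
  simp_rw [ENNReal.mul_iInf_of_ne (measure_ball_pos _ _ one_pos).ne' hb]
  refine le_iInf fun x => le_iInf fun r => le_iInf fun h => ?_
  refine (measure_mono h).trans ((measure_iUnion_le _).trans ?_)
  rw [← ENNReal.tsum_mul_left]
  refine ENNReal.tsum_le_tsum fun i => ?_
  rw [Measure.addHaar_ball _ _ (NNReal.coe_nonneg _), mul_comm, finrank_euclideanSpace_fin,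
    ENNReal.rpow_natCast, ENNReal.ofReal_pow (NNReal.coe_nonneg _), ENNReal.ofReal_coe_nnreal]

theorem lintegral_le_choquet {n : ℕ} (hn0 : 0 < n) {u : EuclideanSpace ℝ (Fin n) → ℝ} (hu : ∀ x, 0 ≤ u x)
    (hm : AEMeasurable u volume) :
    ∫⁻ x, ENNReal.ofReal (u x) ≤
      volume (ball (0 : EuclideanSpace ℝ (Fin n)) 1) * choquet n n univ u := by
  rw [lintegral_eq_lintegral_meas_lt _ (Filter.Eventually.of_forall hu) hm, choquet,
    ← lintegral_const_mul' _ _ measure_ball_lt_top.ne]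
  refine lintegral_mono fun t => ?_
  simpa using volume_le_hContent hn0 {x | t < u x}

theorem tsum_int_le (k : ℤ) (f : ℤ → ℝ≥0∞) :
    ∑' j, (if j ≤ k then f j else 0) = ∑' l : ℕ, f (k - l) := by
  rw [← (Equiv.neg ℤ).tsum_eq]
  have h := tsum_int_ge (-k) fun j => f (-j)
  simp only [Equiv.neg_apply, neg_le (b := k), neg_add_rev, neg_neg] at h ⊢
  rw [h]
  exact tsum_congr fun l => by congr 1; ring

theorem tsum_truncation_le {p : ℝ} (hp : 1 < p) {s : ℝ≥0∞} (hs : s ≠ ⊤) :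
    ∑' j : ℤ, 2 ^ (((j : ℝ) + 1) * p) * (2 ^ (1 - (j : ℝ)) *
      (Ioi ((2 : ℝ≥0∞) ^ ((j : ℝ) - 1))).indicator id s) ≤
      2 ^ (2 * p) * (∑' l : ℕ, 2 ^ (-((l : ℝ) * (p - 1)))) * s ^ p := by
  rcases eq_or_ne s 0 with rfl | hs0
  · simp
  obtain ⟨J, hJ1, hJ2⟩ := ENNReal.exists_mem_Ioc_zpow hs0 hs (y := 2) (by norm_num) (by norm_num)
  rw [← ENNReal.rpow_intCast] at hJ1 hJ2
  calc _ ≤ ∑' j : ℤ, if j ≤ J + 1 then 2 ^ (((j : ℝ) + 1) * p) * (2 ^ (1 - (j : ℝ)) * s) else 0 := by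
        refine ENNReal.tsum_le_tsum fun j => ?_
        by_cases hj : (2 : ℝ≥0∞) ^ ((j : ℝ) - 1) < s
        · have : j ≤ J + 1 := by
            have h1 := hj.trans_le hJ2
            by_contra! h2
            refine absurd h1 (not_lt.2 (ENNReal.rpow_le_rpow_of_exponent_le (by norm_num) ?_))
            have h3 : J + 1 ≤ j - 1 := by omega
            exact_mod_cast h3
          rw [if_pos this, indicator_of_mem (show s ∈ Ioi _ from hj), id]
        · rw [indicator_of_notMem (show s ∉ Ioi _ from hj)]
          simp
    _ = ∑' l : ℕ, 2 ^ (-((l : ℝ) * (p - 1))) * (2 ^ (2 * p) * ((2 ^ (J : ℝ)) ^ (p - 1) * s)) := by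
        rw [tsum_int_le (J + 1) fun j => 2 ^ (((j : ℝ) + 1) * p) * (2 ^ (1 - (j : ℝ)) * s)]
        refine tsum_congr fun l => ?_
        rw [← ENNReal.rpow_mul, ← mul_assoc, ← mul_assoc, ← mul_assoc, two_rpow_mul, two_rpow_mul,
          two_rpow_mul]
        push_cast
        ring_nf
    _ ≤ ∑' l : ℕ, 2 ^ (-((l : ℝ) * (p - 1))) * (2 ^ (2 * p) * (s ^ (p - 1) * s)) := by
        gcongr
    _ = _ := by
        have h3 : s ^ (p - 1) * s = s ^ p := by
          conv_lhs => rw [← ENNReal.rpow_one s, ← ENNReal.rpow_mul, ← ENNReal.rpow_add _ _ hs0 hs]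
          ring_nf
        rw [h3, ENNReal.tsum_mul_right]
        ring

/-- The average of `g` over the dyadic cube with index `m` at scale `k`. -/
noncomputable def dyAvg {n : ℕ} (g : EuclideanSpace ℝ (Fin n) → ℝ≥0∞) (k : ℤ) (m : Fin n → ℤ) :
    ℝ≥0∞ :=
  2 ^ (-((k : ℝ) * n)) * ∫⁻ y in dyCube k m, g y

/-- The cube with index `m` at scale `k` is a maximal dyadic cube on which the average of `g`
exceeds `2 ^ j`. -/
def IsMaximalCube {n : ℕ} (g : EuclideanSpace ℝ (Fin n) → ℝ≥0∞) (j k : ℤ) (m : Fin n → ℤ) : Prop :=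
  2 ^ (j : ℝ) < dyAvg g k m ∧
    ∀ l : ℕ, dyAvg g (k + (l + 1 : ℕ)) (dyPar^[l + 1] m) ≤ 2 ^ (j : ℝ)

open Classical in
/-- The weights attached to the maximal cubes of all levels. -/
noncomputable def maximalWeight {n : ℕ} (κ p : ℝ) (g : EuclideanSpace ℝ (Fin n) → ℝ≥0∞) (k : ℤ)
    (m : Fin n → ℤ) : ℝ≥0∞ :=
  ∑' j : ℤ, if IsMaximalCube g j k m then 2 ^ (((j : ℝ) + 1) * p) * 2 ^ ((k : ℝ) * (κ * p)) else 0

theorem exists_last_above {α : ℕ → ℝ≥0∞} (h0 : α 0 ≠ 0) (htop : α 0 ≠ ⊤)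
    (hlim : ∀ c, 0 < c → ∃ N, ∀ l ≥ N, α l ≤ c) :
    ∃ (j : ℤ) (l : ℕ), α 0 ≤ 2 ^ ((j : ℝ) + 1) ∧ 2 ^ (j : ℝ) < α l ∧
      ∀ i : ℕ, α (l + (i + 1)) ≤ 2 ^ (j : ℝ) := by
  obtain ⟨j, hj1, hj2⟩ := ENNReal.exists_mem_Ioc_zpow h0 htop (y := 2) (by norm_num) (by norm_num)
  rw [← ENNReal.rpow_intCast] at hj1 hj2
  have hex := hlim (2 ^ (j : ℝ)) (ENNReal.rpow_pos (by norm_num) (by norm_num))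
  classical
  have hspec := Nat.find_spec hex
  rcases hN : Nat.find hex with _ | l
  · rw [hN] at hspec
    exact absurd (hspec 0 le_rfl) (not_le.2 hj1)
  · rw [hN] at hspec
    refine ⟨j, l, by simpa using hj2, ?_, fun i => hspec _ (by omega)⟩
    have hmin := Nat.find_min hex (m := l) (by omega)
    push Not at hmin
    obtain ⟨i, hi, hlt⟩ := hmin
    rcases hi.eq_or_lt with rfl | hi
    · exact hlt
    · exact absurd (hspec i hi) (not_le.2 hlt)

theorem rpow_average_le_dySum_maximalWeight {n : ℕ} (hn0 : 0 < n) {κ p : ℝ} (hκ : 0 ≤ κ)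
    (hp : 1 < p) {f : EuclideanSpace ℝ (Fin n) → ℝ} (hf : AEStronglyMeasurable f volume)
    (hI : ∫⁻ y, ENNReal.ofReal |f y| ^ p ≠ ⊤) (k : ℤ) (m : Fin n → ℤ) :
    (2 ^ ((k : ℝ) * (κ - n)) * ∫⁻ y in dyCube k m, ENNReal.ofReal |f y|) ^ p ≤
      dySum (maximalWeight κ p fun y => ENNReal.ofReal |f y|) k m := by
  have hp0 : 0 < p := by linarith
  set g : EuclideanSpace ℝ (Fin n) → ℝ≥0∞ := fun y => ENNReal.ofReal |f y| with hg
  have hJ : ∀ (k : ℤ) m, dyAvg g k m ^ p ≤ 2 ^ (-((k : ℝ) * n)) * ∫⁻ y, g y ^ p := by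
    intro k m
    have := rpow_average_le_average_rpow (κ := 0) hp.le hf k m
    simp only [zero_sub, zero_mul, mul_neg] at this
    exact this.trans (mul_le_mul_right (setLIntegral_le_lintegral _ _) _)
  have h0 : 2 ^ ((k : ℝ) * (κ - n)) * ∫⁻ y in dyCube k m, g y =
      2 ^ ((k : ℝ) * κ) * dyAvg g k m := by
    rw [dyAvg, ← mul_assoc, two_rpow_mul]
    ring_nf
  rw [h0]
  rcases eq_or_ne (dyAvg g k m) 0 with hA | hA
  · simp [hA, hp0]
  have htop : dyAvg g k m ≠ ⊤ := by
    intro h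
    have h1 := hJ k m
    rw [h, ENNReal.top_rpow_of_pos hp0, top_le_iff] at h1
    exact ENNReal.mul_ne_top (ENNReal.rpow_ne_top_of_ne_zero (by norm_num) (by norm_num)) hI h1
  obtain ⟨j, l, hj, hl, hmax⟩ := exists_last_above
    (α := fun l : ℕ => dyAvg g (k + l) (dyPar^[l] m)) (by simpa using hA) (by simpa using htop) (by
      intro c hc
      have hlim : Filter.Tendsto
          (fun l : ℕ => (2 ^ (-((k : ℝ) * n)) * ∫⁻ y, g y ^ p) * (2 ^ (-(n : ℝ))) ^ l)
          Filter.atTop (nhds ((2 ^ (-((k : ℝ) * n)) * ∫⁻ y, g y ^ p) * 0)) := by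
        refine ENNReal.Tendsto.const_mul (ENNReal.tendsto_pow_atTop_nhds_zero_of_lt_one ?_)
          (Or.inr (ENNReal.mul_ne_top
            (ENNReal.rpow_ne_top_of_ne_zero (by norm_num) (by norm_num)) hI))
        exact ENNReal.rpow_lt_one_of_one_lt_of_neg (by norm_num)
          (by have : (0 : ℝ) < n := by exact_mod_cast hn0
              linarith)
      rw [mul_zero] at hlim
      obtain ⟨N, hN⟩ := Filter.eventually_atTop.1 (hlim.eventually
        (gt_mem_nhds (ENNReal.rpow_pos_of_nonneg hc hp0.le : 0 < c ^ p)))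
      refine ⟨N, fun l hl => (ENNReal.rpow_le_rpow_iff hp0).1 ((hJ _ _).trans
        (le_trans (le_of_eq ?_) (hN l hl).le))⟩
      rw [← ENNReal.rpow_natCast, ← ENNReal.rpow_mul, mul_right_comm, two_rpow_mul]
      push_cast
      ring_nf)
  simp only [Nat.cast_zero, add_zero, Function.iterate_zero, id] at hj
  have hM : IsMaximalCube g j (k + l) (dyPar^[l] m) := by
    refine ⟨hl, fun i => ?_⟩
    have := hmax i
    rw [add_comm l, Function.iterate_add_apply] at this
    convert this using 2
    push_cast
    ring
  calc (2 ^ ((k : ℝ) * κ) * dyAvg g k m) ^ p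
      ≤ (2 ^ (((k : ℝ) + l) * κ) * 2 ^ ((j : ℝ) + 1)) ^ p := by
        refine ENNReal.rpow_le_rpow (mul_le_mul' ?_ hj) hp0.le
        refine ENNReal.rpow_le_rpow_of_exponent_le (by norm_num) ?_
        exact mul_le_mul_of_nonneg_right (by simp) hκ
    _ = 2 ^ (((j : ℝ) + 1) * p) * 2 ^ (((k + l : ℤ) : ℝ) * (κ * p)) := by
        rw [ENNReal.mul_rpow_of_nonneg _ _ hp0.le, ← ENNReal.rpow_mul, ← ENNReal.rpow_mul, mul_comm]
        push_cast
        ring_nf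
    _ ≤ maximalWeight κ p g (k + l) (dyPar^[l] m) := by
        classical
        refine le_trans (le_of_eq ?_) (ENNReal.le_tsum j)
        rw [if_pos hM]
    _ ≤ dySum (maximalWeight κ p g) k m :=
        ENNReal.le_tsum (f := fun l : ℕ => maximalWeight κ p g (k + l) (dyPar^[l] m)) l

theorem IsMaximalCube.volume_le {n : ℕ} {g : EuclideanSpace ℝ (Fin n) → ℝ≥0∞} {j k : ℤ}
    {m : Fin n → ℤ} (h : IsMaximalCube g j k m) :
    2 ^ ((k : ℝ) * n) ≤ 2 ^ (1 - (j : ℝ)) *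
      ∫⁻ y in dyCube k m, (Ioi ((2 : ℝ≥0∞) ^ ((j : ℝ) - 1))).indicator id (g y) := by
  set φ := (Ioi ((2 : ℝ≥0∞) ^ ((j : ℝ) - 1))).indicator id
  have htop : ∀ t : ℝ, (2 : ℝ≥0∞) ^ t ≠ ⊤ := fun t =>
    ENNReal.rpow_ne_top_of_ne_zero (by norm_num) (by norm_num)
  have h1 : 2 ^ ((j : ℝ) - 1) * 2 ^ ((k : ℝ) * n) + 2 ^ ((j : ℝ) - 1) * 2 ^ ((k : ℝ) * n) ≤
      2 ^ ((j : ℝ) - 1) * 2 ^ ((k : ℝ) * n) + ∫⁻ y in dyCube k m, φ (g y) := by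
    calc 2 ^ ((j : ℝ) - 1) * 2 ^ ((k : ℝ) * n) + 2 ^ ((j : ℝ) - 1) * 2 ^ ((k : ℝ) * n)
        = 2 ^ ((k : ℝ) * n) * 2 ^ (j : ℝ) := by
          rw [← two_mul, ← mul_assoc]
          nth_rw 1 [← ENNReal.rpow_one 2]
          rw [two_rpow_mul, mul_comm]
          ring_nf
      _ ≤ 2 ^ ((k : ℝ) * n) * dyAvg g k m := mul_le_mul_right h.1.le _
      _ = ∫⁻ y in dyCube k m, g y := by
          rw [dyAvg, ← mul_assoc, two_rpow_mul]
          simp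
      _ ≤ ∫⁻ y in dyCube k m, (φ (g y) + 2 ^ ((j : ℝ) - 1)) := by
          refine lintegral_mono fun y => ?_
          by_cases hy : g y ∈ Ioi ((2 : ℝ≥0∞) ^ ((j : ℝ) - 1))
          · simp [φ, indicator_of_mem hy]
          · exact (not_lt.1 hy).trans le_add_self
      _ ≤ (∫⁻ y in dyCube k m, φ (g y)) + 2 ^ ((j : ℝ) - 1) * 2 ^ ((k : ℝ) * n) := by
          rw [lintegral_add_right _ measurable_const, setLIntegral_const]
          gcongr
          exact volume_dyCube_le k m
      _ = _ := add_comm _ _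
  have h2 := (ENNReal.add_le_add_iff_left (ENNReal.mul_ne_top (htop _) (htop _))).1 h1
  refine le_trans (le_of_eq ?_) (mul_le_mul_right h2 _)
  rw [← mul_assoc, two_rpow_mul]
  simp

open Classical in
theorem tsum_isMaximalCube_le {n : ℕ} (g : EuclideanSpace ℝ (Fin n) → ℝ≥0∞) (j : ℤ) :
    ∑' q : ℤ × (Fin n → ℤ), (if IsMaximalCube g j q.1 q.2 then 2 ^ ((q.1 : ℝ) * n) else 0) ≤
      2 ^ (1 - (j : ℝ)) * ∫⁻ y, (Ioi ((2 : ℝ≥0∞) ^ ((j : ℝ) - 1))).indicator id (g y) := by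
  set φ := (Ioi ((2 : ℝ≥0∞) ^ ((j : ℝ) - 1))).indicator id
  let Z : ℤ × (Fin n → ℤ) → Set (EuclideanSpace ℝ (Fin n)) := fun q =>
    {x | x ∈ dyCube q.1 q.2 ∧ IsMaximalCube g j q.1 q.2}
  have hle : ∀ q q' x, x ∈ Z q → x ∈ Z q' → q.1 ≤ q'.1 → q = q' := by
    rintro ⟨k, m⟩ ⟨k', m'⟩ x ⟨hx, hM⟩ ⟨hx', hM'⟩ (hk : k ≤ k')
    obtain ⟨l, rfl⟩ := Int.le.dest hk
    have h1 := iterate_dyPar_of_inter hx hx'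
    rcases l with _ | l
    · simpa using h1.symm
    · subst h1
      exact absurd hM'.1 (not_lt.2 (hM.2 l))
  have hdisj : Pairwise (Function.onFun Disjoint Z) := by
    intro q q' hne
    refine disjoint_left.2 fun x hx hx' => hne ?_
    rcases le_total q.1 q'.1 with h | h
    · exact hle q q' x hx hx' h
    · exact (hle q' q x hx' hx h).symm
  have hmeas : ∀ q, MeasurableSet (Z q) := fun q =>
    (measurableSet_dyCube q.1 q.2).inter (MeasurableSet.const _)
  calc _ ≤ ∑' q, 2 ^ (1 - (j : ℝ)) * ∫⁻ y in Z q, φ (g y) := by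
        refine ENNReal.tsum_le_tsum fun q => ?_
        split_ifs with h
        · have : Z q = dyCube q.1 q.2 := by
            ext x
            simp [Z, h]
          rw [this]
          exact h.volume_le
        · exact zero_le
    _ = 2 ^ (1 - (j : ℝ)) * ∫⁻ y in ⋃ q, Z q, φ (g y) := by
        rw [ENNReal.tsum_mul_left, lintegral_iUnion hmeas hdisj]
    _ ≤ _ := mul_le_mul_right (setLIntegral_le_lintegral _ _) _

theorem tsum_maximalWeight_le {n : ℕ} {κ p : ℝ} (hp : 1 < p)
    {g : EuclideanSpace ℝ (Fin n) → ℝ≥0∞} (hg : AEMeasurable g volume) (hg' : ∀ x, g x ≠ ⊤) :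
    ∑' (k : ℤ) (m), maximalWeight κ p g k m * 2 ^ ((k : ℝ) * (n - κ * p)) ≤
      2 ^ (2 * p) * (∑' l : ℕ, 2 ^ (-((l : ℝ) * (p - 1)))) * ∫⁻ y, g y ^ p := by
  classical
  have hC : 2 ^ (2 * p) * (∑' l : ℕ, (2 : ℝ≥0∞) ^ (-((l : ℝ) * (p - 1)))) ≠ ⊤ :=
    ENNReal.mul_ne_top (ENNReal.rpow_ne_top_of_ne_zero (by norm_num) (by norm_num))
      (tsum_two_rpow_ne_top (by linarith))
  calc _ = ∑' (q : ℤ × (Fin n → ℤ)) (j : ℤ), (2 : ℝ≥0∞) ^ (((j : ℝ) + 1) * p) *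
        (if IsMaximalCube g j q.1 q.2 then 2 ^ ((q.1 : ℝ) * n) else 0) := by
        rw [ENNReal.tsum_prod']
        refine tsum_congr fun k => tsum_congr fun m => ?_
        rw [maximalWeight, ← ENNReal.tsum_mul_right]
        refine tsum_congr fun j => ?_
        dsimp only
        split_ifs
        · rw [mul_assoc, two_rpow_mul]
          ring_nf
        · simp
    _ = ∑' j : ℤ, (2 : ℝ≥0∞) ^ (((j : ℝ) + 1) * p) * ∑' q : ℤ × (Fin n → ℤ),
        (if IsMaximalCube g j q.1 q.2 then 2 ^ ((q.1 : ℝ) * n) else 0) := by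
        rw [ENNReal.tsum_comm]
        simp_rw [ENNReal.tsum_mul_left]
    _ ≤ ∑' j : ℤ, 2 ^ (((j : ℝ) + 1) * p) * (2 ^ (1 - (j : ℝ)) *
        ∫⁻ y, (Ioi ((2 : ℝ≥0∞) ^ ((j : ℝ) - 1))).indicator id (g y)) :=
        ENNReal.tsum_le_tsum fun j => mul_le_mul_right (tsum_isMaximalCube_le g j) _
    _ = ∫⁻ y, ∑' j : ℤ, 2 ^ (((j : ℝ) + 1) * p) * (2 ^ (1 - (j : ℝ)) *
        (Ioi ((2 : ℝ≥0∞) ^ ((j : ℝ) - 1))).indicator id (g y)) := by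
        have hm : ∀ j : ℤ, AEMeasurable
            (fun y => (Ioi ((2 : ℝ≥0∞) ^ ((j : ℝ) - 1))).indicator id (g y)) volume := fun j =>
          (measurable_id.indicator measurableSet_Ioi).comp_aemeasurable hg
        rw [lintegral_tsum fun j => ((hm j).const_mul _).const_mul _]
        refine tsum_congr fun j => ?_
        rw [lintegral_const_mul'' _ ((hm j).const_mul _), lintegral_const_mul'' _ (hm j)]
    _ ≤ ∫⁻ y, 2 ^ (2 * p) * (∑' l : ℕ, 2 ^ (-((l : ℝ) * (p - 1)))) * g y ^ p :=
        lintegral_mono fun y => tsum_truncation_le hp (hg' y)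
    _ = _ := lintegral_const_mul' _ _ hC

theorem exists_weights {n : ℕ} (hn0 : 0 < n) {δ κ p : ℝ} (hδ0 : 0 < δ) (hδn : δ ≤ (n : ℝ))
    (hκ0 : 0 ≤ κ) (hp1 : δ / n < p) :
    ∃ C : ℝ≥0∞, C ≠ ⊤ ∧ ∀ f : EuclideanSpace ℝ (Fin n) → ℝ, AEStronglyMeasurable f volume →
      choquet n δ univ (fun x => |f x| ^ p) ≠ ⊤ → ∀ ε : ℝ≥0∞, ε ≠ 0 →
        ∃ b : ℤ → (Fin n → ℤ) → ℝ≥0∞,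
          (∀ (k : ℤ) m, (2 ^ ((k : ℝ) * (κ - n)) * ∫⁻ y in dyCube k m, ENNReal.ofReal |f y|) ^ p ≤
            dySum b k m) ∧
          ∑' (k : ℤ) (m), b k m * 2 ^ ((k : ℝ) * (δ - κ * p)) ≤
            C * (choquet n δ univ (fun x => |f x| ^ p) + ε) := by
  have hn0' : (0 : ℝ) < n := by exact_mod_cast hn0
  have hp0 : 0 < p := (div_pos hδ0 hn0').trans hp1
  have htop : ∀ t : ℝ, (2 : ℝ≥0∞) ^ t ≠ ⊤ := fun t =>
    ENNReal.rpow_ne_top_of_ne_zero (by norm_num) (by norm_num)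
  have hpow : ∀ (f : EuclideanSpace ℝ (Fin n) → ℝ) x,
      ENNReal.ofReal |f x| ^ p = ENNReal.ofReal (|f x| ^ p) := fun f x =>
    ENNReal.ofReal_rpow_of_nonneg (abs_nonneg _) hp0.le
  have hfin : ∀ s : ℝ, 0 < s → (1 + ∑' l : ℕ, (2 : ℝ≥0∞) ^ (-((l : ℝ) * s))) *
      (3 ^ n * 2 ^ δ) * 4 ≠ ⊤ := fun s hs =>
    ENNReal.mul_ne_top (ENNReal.mul_ne_top (ENNReal.add_ne_top.2
      ⟨ENNReal.one_ne_top, tsum_two_rpow_ne_top hs⟩)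
      (ENNReal.mul_ne_top (ENNReal.pow_ne_top (by norm_num)) (htop _))) (by norm_num)
  rcases le_or_gt p 1 with hp | hp
  · refine ⟨_, hfin (n * p - δ) ?_, fun f _ hu ε hε =>
      exists_weights_of_le_one hδ0 hκ0 hp0 hp _ _ (hpow f) hu hε⟩
    rw [div_lt_iff₀ hn0'] at hp1
    linarith
  rcases hδn.lt_or_eq with hδ | rfl
  · refine ⟨_, hfin (n * 1 - δ) (by linarith), fun f hf hu ε hε => ?_⟩
    obtain ⟨b, hb, hsum⟩ := exists_weights_of_le_one (κ := κ * p) hδ0 (by positivity) one_pos le_rfl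
      (fun x => ENNReal.ofReal |f x| ^ p) (fun x => |f x| ^ p)
      (fun x => by rw [ENNReal.rpow_one, hpow]) hu hε
    rw [mul_one] at hsum
    refine ⟨b, fun k m => (rpow_average_le_average_rpow hp.le hf k m).trans ?_, hsum⟩
    simpa using hb k m
  · refine ⟨2 ^ (2 * p) * (∑' l : ℕ, 2 ^ (-((l : ℝ) * (p - 1)))) *
      volume (ball (0 : EuclideanSpace ℝ (Fin n)) 1),
      ENNReal.mul_ne_top (ENNReal.mul_ne_top (htop _) (tsum_two_rpow_ne_top (by linarith)))
        measure_ball_lt_top.ne, fun f hf hu ε _ => ?_⟩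
    have hI : ∫⁻ y, ENNReal.ofReal |f y| ^ p ≤
        volume (ball (0 : EuclideanSpace ℝ (Fin n)) 1) *
          choquet n n univ (fun x => |f x| ^ p) := by
      simp_rw [hpow]
      exact lintegral_le_choquet hn0 (fun x => by positivity) (hf.aemeasurable.abs.pow_const p)
    refine ⟨_, rpow_average_le_dySum_maximalWeight hn0 hκ0 hp hf
      (ne_top_of_le_ne_top (ENNReal.mul_ne_top measure_ball_lt_top.ne hu) hI), ?_⟩
    refine (tsum_maximalWeight_le hp hf.aemeasurable.abs.ennreal_ofReal
      fun x => ENNReal.ofReal_ne_top).trans ?_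
    rw [mul_assoc _ (volume _)]
    exact mul_le_mul_right (hI.trans (mul_le_mul_right le_self_add _)) _

theorem le_mul_of_forall_le_mul_add {a b c : ℝ≥0∞} (h : ∀ ε ≠ 0, a ≤ c * (b + ε)) (hc : c ≠ ⊤) :
    a ≤ c * b := by
  refine ENNReal.le_of_forall_pos_le_add fun ε hε _ => ?_
  refine (h (ε / c) (ENNReal.div_ne_zero.2 ⟨by exact_mod_cast hε.ne', hc⟩)).trans ?_
  rw [mul_add]
  exact add_le_add_right ENNReal.mul_div_le _

/-- Adams: boundedness of the fractional maximal operator between Choquet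
integrals w.r.t. Hausdorff contents of different dimensions. For `0 < δ ≤ n`, `0 ≤ κ < n` and
`δ/n < p < δ/κ` (the condition `p < δ/κ`, read as `p < ∞` when `κ = 0`, is encoded as
`κ * p < δ`), there is `c = c(n, δ, κ, p)` such that for every `f ∈ L¹_loc(ℝⁿ)`,
`∫_{ℝⁿ} (M_κ f)^p dH^{δ-κp}_∞ ≤ c ∫_{ℝⁿ} |f|^p dH^δ_∞`. -/
theorem fractional_maximal_bounded_choquet (n : ℕ) (hn : 2 ≤ n) (δ κ p : ℝ)
    (hδ0 : 0 < δ) (hδn : δ ≤ (n : ℝ)) (hκ0 : 0 ≤ κ) (hκn : κ < (n : ℝ))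
    (hp1 : δ / n < p) (hp2 : κ * p < δ) :
    ∃ c : ℝ≥0, 0 < c ∧
      ∀ f : EuclideanSpace ℝ (Fin n) → ℝ, LocallyIntegrable f volume →
        echoquet n (δ - κ * p) Set.univ (fun x => fracMaximal n κ f x ^ p)
          ≤ c * choquet n δ Set.univ fun x => |f x| ^ p := by
  have hn0 : 0 < n := by omega
  have hp0 : 0 < p := (div_pos hδ0 (by exact_mod_cast hn0)).trans hp1
  have htop : ∀ t : ℝ, (2 : ℝ≥0∞) ^ t ≠ ⊤ := fun t =>
    ENNReal.rpow_ne_top_of_ne_zero (by norm_num) (by norm_num)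
  obtain ⟨C, hC, hw⟩ := exists_weights hn0 hδ0 hδn hκ0 hp1
  set D : ℝ≥0∞ := (2 * n + 1) ^ (δ - κ * p) * (2 ^ (n - κ) * 3 ^ n) ^ p * C
  have hD : D ≠ ⊤ := by
    refine ENNReal.mul_ne_top (ENNReal.mul_ne_top ?_ ?_) hC
    · exact ENNReal.rpow_ne_top_of_nonneg (by linarith) (by finiteness)
    · exact ENNReal.rpow_ne_top_of_nonneg hp0.le
        (ENNReal.mul_ne_top (htop _) (ENNReal.pow_ne_top (by norm_num)))
  refine ⟨D.toNNReal + 1, by positivity, fun f hf => ?_⟩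
  rcases eq_or_ne (choquet n δ univ fun x => |f x| ^ p) ⊤ with hu | hu
  · rw [hu, ENNReal.mul_top (by simp)]
    exact le_top
  calc _ ≤ D * choquet n δ univ fun x => |f x| ^ p := by
        refine le_mul_of_forall_le_mul_add (fun ε hε => ?_) hD
        obtain ⟨b, hb, hsum⟩ := hw f hf.aestronglyMeasurable hu ε hε
        refine (echoquet_fracMaximal_le hn0 hκn hp0 (by linarith) f b hb).trans ?_
        rw [mul_assoc _ C]
        exact mul_le_mul_right hsum _
    _ ≤ _ := by
        gcongr
        rw [ENNReal.coe_add, ENNReal.coe_toNNReal hD]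
        exact le_self_add
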